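/- arXiv:math/0503685 — 2 statements merged into one kernel-verified Lean document; each statement's English description precedes it below -/
import Mathlib

section
/- Let σ_(i,d) = {i−d+1, i−d+2, …, i} ⊂ [n]. Then for every homogeneous ideal I ⊂ E one has m_{≤i}(Gin^E(I), d) = rank(M_{σ_(i,d)}(I,d)), where rank(M_{σ_(i,d)}(I,d)) is interpreted as 0 if i < d. -/
/-- The exterior algebra `E = ⋀ V` of an `n`-dimensional `K`-vector space `V`
with distinguished basis `e_1, …, e_n` (modeled on `V = Fin n → K`). -/
abbrev ExtAlg (K : Type) [Field K] (n : ℕ) := ExteriorAlgebra K (Fin n → K)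

/-- The monomial `e_σ = e_{j_1} ∧ ⋯ ∧ e_{j_d}` for `σ = {j_1 < ⋯ < j_d} ⊆ [n]`. -/
noncomputable def eMon (K : Type) [Field K] (n : ℕ) (σ : Finset (Fin n)) : ExtAlg K n :=
  ((σ.sort (· ≤ ·)).map fun k => ExteriorAlgebra.ι K (Pi.single k (1 : K))).prod

/-- The span of the degree-`d` monomials: the image of `⋀^d V` in `E`. -/
noncomputable def monSpan (K : Type) [Field K] (n : ℕ) (d : ℕ) :
    Submodule K (ExtAlg K n) :=
  Submodule.span K {x | ∃ σ : Finset (Fin n), σ.card = d ∧ x = eMon K n σ}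

/-- A subspace of `E` is a (two-sided) ideal. -/
def IsIdealE {K : Type} [Field K] {n : ℕ} (I : Submodule K (ExtAlg K n)) : Prop :=
  ∀ x y : ExtAlg K n, y ∈ I → x * y ∈ I ∧ y * x ∈ I

/-- A subspace of `E` is (graded) homogeneous. -/
def IsHomogE {K : Type} [Field K] {n : ℕ} (I : Submodule K (ExtAlg K n)) : Prop :=
  I = ⨆ d : ℕ, I ⊓ monSpan K n d

/-- The two-sided ideal of `E` generated by a set. -/
noncomputable def idealSpanE (K : Type) [Field K] (n : ℕ) (s : Set (ExtAlg K n)) :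
    Submodule K (ExtAlg K n) :=
  Submodule.span K {x | ∃ a ∈ s, ∃ u v : ExtAlg K n, x = u * a * v}

/-- The exterior face ideal `J_Δ ⊆ E`, generated by the monomials `e_σ`, `σ ∉ Δ`. -/
noncomputable def faceIdealE (K : Type) [Field K] {n : ℕ} (Δ : Set (Finset (Fin n))) :
    Submodule K (ExtAlg K n) :=
  idealSpanE K n {x | ∃ σ : Finset (Fin n), σ ∉ Δ ∧ x = eMon K n σ}

/-- `e_τ ≤_rev e_σ` in the reverse lexicographic order induced by `e_1 > ⋯ > e_n`:
either `τ = σ`, or the largest element of the symmetric difference belongs to `τ`. -/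
def revLexLe {n : ℕ} (τ σ : Finset (Fin n)) : Prop :=
  τ = σ ∨ ∃ k ∈ τ, k ∉ σ ∧ ∀ l ∈ σ, l ∉ τ → l < k

/-- The span of the monomials `e_ρ` of degree `|σ|` with `e_ρ ≤_rev e_σ`. -/
noncomputable def monSpanLe (K : Type) [Field K] {n : ℕ} (σ : Finset (Fin n)) :
    Submodule K (ExtAlg K n) :=
  Submodule.span K
    {x | ∃ ρ : Finset (Fin n), ρ.card = σ.card ∧ revLexLe ρ σ ∧ x = eMon K n ρ}

/-- The span of the monomials `e_ρ` of degree `|σ|` with `e_ρ <_rev e_σ`. -/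
noncomputable def monSpanLt (K : Type) [Field K] {n : ℕ} (σ : Finset (Fin n)) :
    Submodule K (ExtAlg K n) :=
  Submodule.span K
    {x | ∃ ρ : Finset (Fin n), ρ.card = σ.card ∧ revLexLe ρ σ ∧ ρ ≠ σ ∧ x = eMon K n ρ}

/-- `e_σ` is the initial monomial (with respect to `<_rev`) of some element of `I`. -/
def IsInitialMonomial {K : Type} [Field K] {n : ℕ} (I : Submodule K (ExtAlg K n))
    (σ : Finset (Fin n)) : Prop :=
  ∃ f ∈ I, f ∈ monSpanLe K σ ∧ f ∉ monSpanLt K σ ∧ f ≠ 0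

/-- The initial ideal `in_{<rev}(I)` of a homogeneous ideal `I ⊆ E`. -/
noncomputable def initialIdealE (K : Type) [Field K] {n : ℕ}
    (I : Submodule K (ExtAlg K n)) : Submodule K (ExtAlg K n) :=
  Submodule.span K {x | ∃ σ : Finset (Fin n), IsInitialMonomial I σ ∧ x = eMon K n σ}

/-- The algebra automorphism of `E` induced by an (invertible) matrix `g`,
i.e. the action of `GL(n;K)` on `E`. -/
noncomputable def matAlgMap (K : Type) [Field K] {n : ℕ} (g : Matrix (Fin n) (Fin n) K) :
    ExtAlg K n →ₐ[K] ExtAlg K n :=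
  ExteriorAlgebra.map (Matrix.toLin' g)

/-- The image `φ(I)` of a subspace `I ⊆ E` under the action of a matrix `φ = g`. -/
noncomputable def applyMat (K : Type) [Field K] {n : ℕ} (g : Matrix (Fin n) (Fin n) K)
    (I : Submodule K (ExtAlg K n)) : Submodule K (ExtAlg K n) :=
  Submodule.map (matAlgMap K g).toLinearMap I

/-- `J` is the generic initial ideal `Gin^E(I)` of `I`: there is a nonempty Zariski
open subset `U` of `GL(n;K)` (the nonvanishing locus of a nonzero polynomial in the
matrix entries) such that `in_{<rev}(φ(I)) = J` for every `φ ∈ U`. -/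
def IsGinE {K : Type} [Field K] {n : ℕ} (I J : Submodule K (ExtAlg K n)) : Prop :=
  ∃ p : MvPolynomial (Fin n × Fin n) K, p ≠ 0 ∧
    ∀ g : Matrix (Fin n) (Fin n) K, IsUnit g.det →
      MvPolynomial.eval (fun kl => g kl.1 kl.2) p ≠ 0 →
        initialIdealE K (applyMat K g I) = J

/-- `m_{≤i}(J, d)`: the number of monomials `e_σ ∈ J` of degree `d` with
`m(e_σ) = max σ ≤ i` (in the `1`-based labelling `[n] = {1, …, n}`). -/
noncomputable def mLeE {K : Type} [Field K] {n : ℕ} (J : Submodule K (ExtAlg K n))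
    (i d : ℕ) : ℕ :=
  Nat.card {σ : Finset (Fin n) // σ.card = d ∧ (∀ k ∈ σ, (k : ℕ) < i) ∧ eMon K n σ ∈ J}

open Classical in
/-- The matrix `M_τ(I,d)`: the submatrix of `M(I,d) = (α_a^σ)` consisting of the
columns indexed by the `d`-element subsets `σ` with `e_τ ≤_rev e_σ` (realized by
zeroing out all other columns, which does not change the rank). -/
noncomputable def MtauMatrix {K : Type} [Field K] {n : ℕ} {s : ℕ}
    (α : Fin s → Finset (Fin n) → K) (d : ℕ) (τ : Finset (Fin n)) :
    Matrix (Fin s) (Finset (Fin n)) K :=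
  Matrix.of fun a σ => if σ.card = d ∧ τ.card = d ∧ revLexLe τ σ then α a σ else 0

open Classical in
/-- The matrix `M'_τ(I,d)`: the submatrix of `M_τ(I,d)` obtained by removing the
column indexed by `τ` (realized by zeroing out all other columns). -/
noncomputable def MtauMatrix' {K : Type} [Field K] {n : ℕ} {s : ℕ}
    (α : Fin s → Finset (Fin n) → K) (d : ℕ) (τ : Finset (Fin n)) :
    Matrix (Fin s) (Finset (Fin n)) K :=
  Matrix.of fun a σ =>
    if σ.card = d ∧ τ.card = d ∧ revLexLe τ σ ∧ σ ≠ τ then α a σ else 0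

/-- `f : Fin s → E` is a `K`-basis of the degree-`d` part `I_d = I ⊓ ⋀^d V` of `I`. -/
def IsBasisOfDegPart {K : Type} [Field K] {n : ℕ} (I : Submodule K (ExtAlg K n))
    (d s : ℕ) (f : Fin s → ExtAlg K n) : Prop :=
  LinearIndependent K f ∧ Submodule.span K (Set.range f) = I ⊓ monSpan K n d

/-- `α` is the coefficient matrix of `φ(f_1), …, φ(f_s)` in the monomial basis:
`φ(f_a) = ∑_{|σ| = d} α_a^σ e_σ`. -/
def IsCoeffMatrix {K : Type} [Field K] {n : ℕ} (g : Matrix (Fin n) (Fin n) K)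
    {s : ℕ} (f : Fin s → ExtAlg K n) (α : Fin s → Finset (Fin n) → K) (d : ℕ) : Prop :=
  ∀ a : Fin s, matAlgMap K g (f a) =
    ∑ σ ∈ Finset.univ.filter (fun σ : Finset (Fin n) => σ.card = d), α a σ • eMon K n σ

/-- `σ_(i,d) = {i − d + 1, i − d + 2, …, i} ⊆ [n]` (in `1`-based labelling). -/
def sigmaSet (n i d : ℕ) : Finset (Fin n) :=
  Finset.univ.filter fun k : Fin n => i - d ≤ (k : ℕ) ∧ (k : ℕ) < i

open Module

open Classical in
/-- If a family of linear functionals is indexed by a finite subset `S` of a linear order, then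
the codimension of the common kernel is the number of indices `a ∈ S` whose functional does not
vanish on the common kernel of the preceding ones. -/
theorem finrank_iInf_ker_add_card_pivots {K V ι : Type*} [Field K] [AddCommGroup V] [Module K V]
    [FiniteDimensional K V] [LinearOrder ι] (c : ι → V →ₗ[K] K) (S : Finset ι) :
    finrank K (⨅ a ∈ S, LinearMap.ker (c a) : Submodule K V) +
      (S.filter fun a => ∃ w, c a w ≠ 0 ∧ ∀ b ∈ S, b < a → c b w = 0).card = finrank K V := by
  induction S using Finset.induction_on_max with
  | empty =>
    have htop : (⨅ a ∈ (∅ : Finset ι), LinearMap.ker (c a)) = ⊤ := by simp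
    rw [htop, finrank_top, Finset.filter_empty, Finset.card_empty, add_zero]
  | insert m S hm ih =>
    have hmS : m ∉ S := fun h => lt_irrefl m (hm m h)
    set N : Submodule K V := ⨅ a ∈ S, LinearMap.ker (c a) with hN
    have hmemN : ∀ w, w ∈ N ↔ ∀ a ∈ S, c a w = 0 := by simp [hN]
    have hold : (S.filter fun a => ∃ w, c a w ≠ 0 ∧ ∀ b ∈ insert m S, b < a → c b w = 0) =
        S.filter fun a => ∃ w, c a w ≠ 0 ∧ ∀ b ∈ S, b < a → c b w = 0 := by
      refine Finset.filter_congr fun a ha => exists_congr fun w => and_congr_right fun _ => ?_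
      simp [(hm a ha).not_gt]
    have hnew : (∃ w, c m w ≠ 0 ∧ ∀ b ∈ insert m S, b < m → c b w = 0) ↔
        (c m).domRestrict N ≠ 0 := by
      rw [ne_eq, LinearMap.ext_iff, not_forall]
      constructor
      · rintro ⟨w, hw, hb⟩
        exact ⟨⟨w, (hmemN w).2 fun a ha => hb a (Finset.mem_insert_of_mem ha) (hm a ha)⟩, hw⟩
      · rintro ⟨⟨w, hwN⟩, hw⟩
        refine ⟨w, hw, fun b hb hlt => (hmemN w).1 hwN b ?_⟩
        exact (Finset.mem_insert.1 hb).resolve_left hlt.ne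
    have hker : (LinearMap.ker ((c m).domRestrict N)).map N.subtype =
        ⨅ a ∈ insert m S, LinearMap.ker (c a) := by
      rw [Finset.iInf_insert, ← hN]
      ext w
      simp [and_comm]
    have hfin : finrank K (⨅ a ∈ insert m S, LinearMap.ker (c a) : Submodule K V) =
        finrank K (LinearMap.ker ((c m).domRestrict N)) := by
      rw [← hker]
      exact (Submodule.equivMapOfInjective _ N.injective_subtype _).finrank_eq.symm
    have hrank := ((c m).domRestrict N).finrank_range_add_finrank_ker
    rw [Finset.filter_insert, hold, hfin]
    by_cases h₀ : (c m).domRestrict N = 0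
    · rw [if_neg (by rw [hnew]; exact not_not.2 h₀)]
      rw [h₀, LinearMap.range_zero, finrank_bot] at hrank
      rw [h₀]
      omega
    · rw [if_pos (hnew.2 h₀), Finset.card_insert_of_notMem (by simp [hmS])]
      rw [LinearMap.range_eq_top.2 (LinearMap.surjective h₀), finrank_top, finrank_self] at hrank
      omega

/-- The monomial basis of the exterior algebra. -/
noncomputable def eMonBasis (K : Type) [Field K] (n : ℕ) :
    Basis (Finset (Fin n)) K (ExtAlg K n) :=
  (Pi.basisFun K (Fin n)).ExteriorAlgebra

theorem eMonBasis_apply (K : Type) [Field K] (n : ℕ) (σ : Finset (Fin n)) :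
    eMonBasis K n σ = eMon K n σ := by
  rw [eMonBasis, ExteriorAlgebra.basis_apply_ofCard (n := σ.card) _ rfl, eMon]
  rw [ExteriorAlgebra.ιMulti_family, ExteriorAlgebra.ιMulti_apply]
  congr 1
  apply List.ext_getElem
  · simp
  · intro k h₁ h₂
    simp [Finset.orderEmbOfFin_apply, Set.powersetCard.ofFinEmbEquiv_symm_apply]

/-- Membership in a span of monomials is a condition on the support. -/
theorem mem_span_eMon_iff {K : Type} [Field K] {n : ℕ} (P : Finset (Fin n) → Prop)
    (x : ExtAlg K n) :
    x ∈ Submodule.span K {x | ∃ σ, P σ ∧ x = eMon K n σ} ↔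
      ∀ σ, (eMonBasis K n).repr x σ ≠ 0 → P σ := by
  have h : {x | ∃ σ, P σ ∧ x = eMon K n σ} = eMonBasis K n '' {σ | P σ} := by
    ext y
    simp [eMonBasis_apply, eq_comm]
  rw [h, Basis.mem_span_image]
  simp [Set.subset_def]

theorem eMon_mem_span_eMon_iff {K : Type} [Field K] {n : ℕ} (P : Finset (Fin n) → Prop)
    (τ : Finset (Fin n)) :
    eMon K n τ ∈ Submodule.span K {x | ∃ σ, P σ ∧ x = eMon K n σ} ↔ P τ := by
  classical
  rw [mem_span_eMon_iff, ← eMonBasis_apply, Basis.repr_self]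
  simp [Finsupp.single_apply]

theorem monSpan_eq_exteriorPower (K : Type) [Field K] (n d : ℕ) :
    monSpan K n d = ⋀[K]^d (Fin n → K) := by
  have h := congrArg (Submodule.map (Submodule.subtype (⋀[K]^d (Fin n → K))))
    ((Pi.basisFun K (Fin n)).exteriorPower d).span_eq
  rw [Submodule.map_span, Submodule.map_top, Submodule.range_subtype] at h
  rw [← h, monSpan]
  congr 1
  ext x
  constructor
  · rintro ⟨σ, hσ, rfl⟩
    refine ⟨_, ⟨Set.powersetCard.ofCard hσ, rfl⟩, ?_⟩
    rw [← eMonBasis_apply, eMonBasis, ExteriorAlgebra.basis_apply_ofCard _ hσ]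
    simp
  · rintro ⟨_, ⟨σ, rfl⟩, rfl⟩
    refine ⟨σ.1, σ.2, ?_⟩
    rw [← eMonBasis_apply, eMonBasis, ExteriorAlgebra.basis_eq_coe_basis]
    rfl

theorem matAlgMap_mem_monSpan {K : Type} [Field K] {n d : ℕ} (g : Matrix (Fin n) (Fin n) K)
    {x : ExtAlg K n} (hx : x ∈ monSpan K n d) : matAlgMap K g x ∈ monSpan K n d := by
  rw [monSpan_eq_exteriorPower, ← ExteriorAlgebra.ιMulti_span_fixedDegree] at hx ⊢
  induction hx using Submodule.span_induction with
  | mem x h =>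
    obtain ⟨v, rfl⟩ := h
    rw [matAlgMap, ExteriorAlgebra.map_apply_ιMulti]
    exact Submodule.subset_span ⟨_, rfl⟩
  | zero => simp
  | add x y _ _ hx hy => rw [map_add]; exact add_mem hx hy
  | smul a x _ hx => rw [map_smul]; exact Submodule.smul_mem _ a hx

theorem mem_monSpan_of_matAlgMap_mem {K : Type} [Field K] {n d : ℕ}
    {g : Matrix (Fin n) (Fin n) K} (hg : IsUnit g.det) {x : ExtAlg K n}
    (hx : matAlgMap K g x ∈ monSpan K n d) : x ∈ monSpan K n d := by
  have h := matAlgMap_mem_monSpan g⁻¹ hx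
  have hcomp : (matAlgMap K g⁻¹).comp (matAlgMap K g) = AlgHom.id K _ := by
    rw [matAlgMap, matAlgMap, ExteriorAlgebra.map_comp_map, ← Matrix.toLin'_mul,
      Matrix.nonsing_inv_mul _ hg, Matrix.toLin'_one, ExteriorAlgebra.map_id]
  rwa [← AlgHom.comp_apply, hcomp] at h

theorem revLexLe_iff_toColex_le {n : ℕ} (τ σ : Finset (Fin n)) :
    revLexLe τ σ ↔ toColex σ ≤ toColex τ := by
  rw [le_iff_eq_or_lt, Finset.Colex.toColex_lt_toColex_iff_exists_forall_lt, revLexLe,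
    toColex_inj, eq_comm]

theorem card_sigmaSet {n i d : ℕ} (hi : i ≤ n) : (sigmaSet n i d).card = min i d := by
  have h : (sigmaSet n i d).map Fin.valEmbedding = Finset.Ico (i - d) i := by
    ext k
    simp only [sigmaSet, Finset.mem_map, Finset.mem_filter, Finset.mem_univ, true_and,
      Fin.valEmbedding_apply, Finset.mem_Ico]
    constructor
    · rintro ⟨k, hk, rfl⟩
      exact hk
    · intro hk
      exact ⟨⟨k, by omega⟩, hk, rfl⟩
  rw [← Finset.card_map Fin.valEmbedding, h, Nat.card_Ico]
  omega

/-- The `d`-subsets dominating `σ_(i,d)` in the reverse lexicographic order are those contained in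
`[i]`. -/
theorem revLexLe_sigmaSet_iff {n i d : ℕ} {σ : Finset (Fin n)} (hσ : σ.card = d)
    (hτ : (sigmaSet n i d).card = d) :
    revLexLe (sigmaSet n i d) σ ↔ ∀ k ∈ σ, (k : ℕ) < i := by
  constructor
  · rintro (rfl | ⟨k, hk, -, hlt⟩) l hl
    · simp only [sigmaSet, Finset.mem_filter] at hl
      exact hl.2.2
    · by_contra hli
      have hlk := hlt l hl (by simp [sigmaSet]; omega)
      simp only [sigmaSet, Finset.mem_filter] at hk
      have : (l : ℕ) < k := hlk
      omega
  · intro h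
    by_cases hne : sigmaSet n i d = σ
    · exact Or.inl hne
    right
    obtain ⟨k, hk, hkσ⟩ : ∃ k ∈ sigmaSet n i d, k ∉ σ := by
      by_contra! hsub
      exact hne (Finset.eq_of_subset_of_card_le hsub (by omega))
    refine ⟨k, hk, hkσ, fun l hl hl' => ?_⟩
    have hli := h l hl
    simp only [sigmaSet, Finset.mem_filter, Finset.mem_univ, true_and] at hk hl'
    change (l : ℕ) < k
    omega

theorem mem_columns_sigmaSet_iff {n i d : ℕ} (hi : i ≤ n) (σ : Finset (Fin n)) :
    σ.card = d ∧ (sigmaSet n i d).card = d ∧ revLexLe (sigmaSet n i d) σ ↔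
      σ.card = d ∧ ∀ k ∈ σ, (k : ℕ) < i := by
  refine and_congr_right fun hσ => ⟨fun h => (revLexLe_sigmaSet_iff hσ h.1).1 h.2, fun h => ?_⟩
  have hsub : σ.map Fin.valEmbedding ⊆ Finset.range i := fun k hk => by
    obtain ⟨l, hl, rfl⟩ := Finset.mem_map.1 hk
    exact Finset.mem_range.2 (h l hl)
  have hle := Finset.card_le_card hsub
  rw [Finset.card_map, Finset.card_range, hσ] at hle
  have hτ : (sigmaSet n i d).card = d := by rw [card_sigmaSet hi, min_eq_right hle]
  exact ⟨hτ, (revLexLe_sigmaSet_iff hσ hτ).2 h⟩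

/-- Initial monomials in terms of coordinates. -/
theorem isInitialMonomial_iff {K : Type} [Field K] {n : ℕ} (I : Submodule K (ExtAlg K n))
    (σ : Finset (Fin n)) :
    IsInitialMonomial I σ ↔ ∃ x ∈ I, x ∈ monSpan K n σ.card ∧ (eMonBasis K n).repr x σ ≠ 0 ∧
      ∀ ρ : Finset (Fin n), toColex ρ < toColex σ → (eMonBasis K n).repr x ρ = 0 := by
  have hle : ∀ x, x ∈ monSpanLe K σ ↔ ∀ ρ, (eMonBasis K n).repr x ρ ≠ 0 →
      ρ.card = σ.card ∧ toColex σ ≤ toColex ρ := by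
    intro x
    rw [← mem_span_eMon_iff, monSpanLe]
    simp only [revLexLe_iff_toColex_le, and_assoc]
  have hlt : ∀ x, x ∈ monSpanLt K σ ↔ ∀ ρ, (eMonBasis K n).repr x ρ ≠ 0 →
      ρ.card = σ.card ∧ toColex σ ≤ toColex ρ ∧ ρ ≠ σ := by
    intro x
    rw [← mem_span_eMon_iff, monSpanLt]
    simp only [revLexLe_iff_toColex_le, and_assoc]
  simp only [IsInitialMonomial, hle, hlt, monSpan, mem_span_eMon_iff]
  refine exists_congr fun x => and_congr_right fun _ => ⟨?_, ?_⟩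
  · rintro ⟨h₁, h₂, -⟩
    refine ⟨fun ρ hρ => (h₁ ρ hρ).1, fun h₀ => h₂ fun ρ hρ => ?_, fun ρ hρ => ?_⟩
    · exact ⟨(h₁ ρ hρ).1, (h₁ ρ hρ).2, fun h => hρ (h ▸ h₀)⟩
    · by_contra h
      exact (h₁ ρ h).2.not_gt hρ
  · rintro ⟨h₁, h₂, h₃⟩
    refine ⟨fun ρ hρ => ⟨h₁ ρ hρ, le_of_not_gt fun h => hρ (h₃ ρ h)⟩,
      fun h => (h σ h₂).2.2 rfl, ?_⟩
    rintro rfl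
    simp at h₂

/-- Coordinates of `φ(∑ x_a f_a)` in the monomial basis. -/
theorem eMonBasis_repr_matAlgMap_sum {K : Type} [Field K] {n d s : ℕ}
    {g : Matrix (Fin n) (Fin n) K} {f : Fin s → ExtAlg K n} {α : Fin s → Finset (Fin n) → K}
    (hα : IsCoeffMatrix g f α d) (x : Fin s → K) {σ : Finset (Fin n)} (hσ : σ.card = d) :
    (eMonBasis K n).repr (matAlgMap K g (∑ a, x a • f a)) σ = ∑ a, x a * α a σ := by
  classical
  simp only [map_sum, map_smul, hα _, ← eMonBasis_apply, Basis.repr_self, Finsupp.coe_finsetSum,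
    Finset.sum_apply, Finsupp.coe_smul, Pi.smul_apply, smul_eq_mul]
  refine Finset.sum_congr rfl fun a _ => ?_
  simp [Finsupp.single_apply, hσ]

/-- For a `d`-element set, being an initial monomial of `φ(I)` is a pivot condition on the
coefficient matrix. -/
theorem isInitialMonomial_applyMat_iff {K : Type} [Field K] {n d s : ℕ}
    {I : Submodule K (ExtAlg K n)} {g : Matrix (Fin n) (Fin n) K} (hg : IsUnit g.det)
    {f : Fin s → ExtAlg K n} (hf : IsBasisOfDegPart I d s f) {α : Fin s → Finset (Fin n) → K}
    (hα : IsCoeffMatrix g f α d) {σ : Finset (Fin n)} (hσ : σ.card = d) :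
    IsInitialMonomial (applyMat K g I) σ ↔ ∃ x : Fin s → K, ∑ a, x a * α a σ ≠ 0 ∧
      ∀ ρ : Finset (Fin n), ρ.card = d → toColex ρ < toColex σ → ∑ a, x a * α a ρ = 0 := by
  rw [isInitialMonomial_iff, hσ]
  constructor
  · rintro ⟨_, ⟨y, hyI, rfl⟩, hy, h₁, h₂⟩
    have hmem : y ∈ I ⊓ monSpan K n d := ⟨hyI, mem_monSpan_of_matAlgMap_mem hg hy⟩
    rw [← hf.2, Submodule.mem_span_range_iff_exists_fun] at hmem
    obtain ⟨x, rfl⟩ := hmem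
    refine ⟨x, ?_, fun ρ hρ hlt => ?_⟩
    · rw [← eMonBasis_repr_matAlgMap_sum hα x hσ]
      exact h₁
    · rw [← eMonBasis_repr_matAlgMap_sum hα x hρ]
      exact h₂ ρ hlt
  · rintro ⟨x, h₁, h₂⟩
    have hmem : ∑ a, x a • f a ∈ I ⊓ monSpan K n d := by
      rw [← hf.2, Submodule.mem_span_range_iff_exists_fun]
      exact ⟨x, rfl⟩
    have hdeg := matAlgMap_mem_monSpan g hmem.2
    refine ⟨_, ⟨_, hmem.1, rfl⟩, hdeg, ?_, fun ρ hlt => ?_⟩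
    · rw [← eMonBasis_repr_matAlgMap_sum hα x hσ] at h₁
      exact h₁
    · by_contra hne
      have hρ : ρ.card = d := (mem_span_eMon_iff _ _).1 hdeg ρ hne
      refine hne ?_
      rw [← h₂ ρ hρ hlt, ← eMonBasis_repr_matAlgMap_sum hα x hρ]
      rfl

open Classical in
/-- The rank of a matrix all of whose columns outside a set `S` vanish is the number of pivots in
`S`, with respect to any linear order on the columns. -/
theorem rank_eq_card_pivots {K ι : Type*} [Field K] [Fintype ι] [LinearOrder ι] {s : ℕ}
    (M : Matrix (Fin s) ι K) (S : Finset ι) (hS : ∀ a, ∀ σ ∉ S, M a σ = 0) :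
    M.rank = (S.filter fun σ => ∃ x : Fin s → K, ∑ a, x a * M a σ ≠ 0 ∧
      ∀ ρ ∈ S, ρ < σ → ∑ a, x a * M a ρ = 0).card := by
  have h₁ := finrank_iInf_ker_add_card_pivots
    (fun σ => (LinearMap.proj σ).comp M.transpose.mulVecLin) S
  have h₂ := M.transpose.mulVecLin.finrank_range_add_finrank_ker
  have hker : (⨅ σ ∈ S, LinearMap.ker ((LinearMap.proj σ).comp M.transpose.mulVecLin)) =
      LinearMap.ker M.transpose.mulVecLin := by
    ext x
    simp only [Submodule.mem_iInf, LinearMap.mem_ker, LinearMap.comp_apply, LinearMap.proj_apply]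
    constructor
    · intro h
      ext σ
      by_cases hσ : σ ∈ S
      · exact h σ hσ
      · simp [Matrix.vecMul, dotProduct, hS _ σ hσ]
    · intro h σ _
      rw [h, Pi.zero_apply]
  rw [hker] at h₁
  rw [← Matrix.rank_transpose, Matrix.rank]
  simp only [LinearMap.comp_apply, LinearMap.proj_apply, Matrix.mulVecLin_apply, Matrix.mulVec,
    dotProduct, Matrix.transpose_apply, mul_comm (M _ _)] at h₁
  omega

/-- **Corollary 1.4.** Let `σ_(i,d) = {i−d+1, …, i} ⊆ [n]`. Then for every
homogeneous ideal `I ⊆ E` one has `m_{≤i}(Gin^E(I), d) = rank(M_{σ_(i,d)}(I,d))`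
(the rank being interpreted as `0` when `i < d`). -/
theorem mLe_gin_eq_rank_Mtau (K : Type) [Field K] [Infinite K] (n : ℕ)
    (I : Submodule K (ExtAlg K n)) (hIdeal : IsIdealE I) (hHom : IsHomogE I)
    (J : Submodule K (ExtAlg K n)) (hGin : IsGinE I J)
    (g : Matrix (Fin n) (Fin n) K) (hg : IsUnit g.det)
    (hin : initialIdealE K (applyMat K g I) = J)
    (d s : ℕ) (f : Fin s → ExtAlg K n) (hf : IsBasisOfDegPart I d s f)
    (α : Fin s → Finset (Fin n) → K) (hα : IsCoeffMatrix g f α d) (i : ℕ) (hi : i ≤ n) :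
    mLeE J i d = (MtauMatrix α d (sigmaSet n i d)).rank := by
  classical
  let colexOrder : LinearOrder (Finset (Fin n)) := LinearOrder.lift' toColex toColex.injective
  set M := MtauMatrix α d (sigmaSet n i d) with hM
  let S : Finset (Finset (Fin n)) := Finset.univ.filter fun σ => σ.card = d ∧ ∀ k ∈ σ, (k : ℕ) < i
  have hmemS : ∀ σ, σ ∈ S ↔ σ.card = d ∧ ∀ k ∈ σ, (k : ℕ) < i := by simp [S]
  have hM_mem : ∀ a, ∀ σ ∈ S, M a σ = α a σ := fun a σ hσ => by
    rw [hM, MtauMatrix, Matrix.of_apply,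
      if_pos ((mem_columns_sigmaSet_iff hi σ).2 ((hmemS σ).1 hσ))]
  have hM_notMem : ∀ a, ∀ σ ∉ S, M a σ = 0 := fun a σ hσ => by
    rw [hM, MtauMatrix, Matrix.of_apply,
      if_neg fun h => hσ ((hmemS σ).2 ((mem_columns_sigmaSet_iff hi σ).1 h))]
  rw [rank_eq_card_pivots M S hM_notMem, mLeE, Nat.card_eq_fintype_card, Fintype.card_subtype]
  congr 1
  ext σ
  rw [Finset.mem_filter, Finset.mem_filter, hmemS, and_assoc]
  simp only [Finset.mem_univ, true_and]
  refine and_congr_right fun hσ => and_congr_right fun hσi => ?_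
  rw [← hin, initialIdealE, eMon_mem_span_eMon_iff, isInitialMonomial_applyMat_iff hg hf hα hσ]
  have hσS : σ ∈ S := (hmemS σ).2 ⟨hσ, hσi⟩
  refine exists_congr fun x => and_congr (by simp only [hM_mem _ σ hσS]) ⟨?_, ?_⟩
  · intro h ρ hρ hlt
    simp only [hM_mem _ ρ hρ]
    exact h ρ ((hmemS ρ).1 hρ).1 hlt
  · intro h ρ hρ hlt
    have hρS : ρ ∈ S := by
      refine (hmemS ρ).2 ⟨hρ, fun k hk => ?_⟩
      by_cases hkσ : k ∈ σ
      · exact hσi k hkσ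
      · obtain ⟨b, hb, -, hkb⟩ := hlt.le hk hkσ
        exact lt_of_le_of_lt hkb (hσi b hb)
    have h₀ := h ρ hρS hlt
    simpa only [hM_mem _ ρ hρS] using h₀
end

section
/- Let Δ be a simplicial complex on [n] over an infinite field K, and let 1 ≤ p < q ≤ n. Then for all i and d one has m_{≤i}(Gin^E(J_Δ), d) ≥ m_{≤i}(Gin^E(J_{Shift_{pq}(Δ)}), d). -/
open Classical in
/-- `C_{ij}(σ)`, the basic combinatorial shifting operation on a single face. -/
noncomputable def shiftFace {n : ℕ} (Δ : Set (Finset (Fin n))) (i j : Fin n)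
    (σ : Finset (Fin n)) : Finset (Fin n) :=
  if i ∈ σ ∧ j ∉ σ ∧ insert j (σ.erase i) ∉ Δ then insert j (σ.erase i) else σ

/-- `Shift_{ij}(Δ)`. -/
noncomputable def shiftOp {n : ℕ} (Δ : Set (Finset (Fin n))) (i j : Fin n) :
    Set (Finset (Fin n)) :=
  (shiftFace Δ i j) '' Δ

/-- A simplicial complex on `[n]`, modeled as a set of finsets of `Fin n`. -/
def IsSimplicialComplex {n : ℕ} (Δ : Set (Finset (Fin n))) : Prop :=
  (∀ j : Fin n, {j} ∈ Δ) ∧ ∀ σ ∈ Δ, ∀ τ : Finset (Fin n), τ ⊆ σ → τ ∈ Δ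

section Monomials

open ExteriorAlgebra

variable {K : Type} [Field K] {n : ℕ}

/-- The basis of the exterior algebra formed by the monomials `eMon K n σ`. -/
noncomputable def monBasis (K : Type) [Field K] (n : ℕ) :
    Module.Basis (Finset (Fin n)) K (ExtAlg K n) :=
  (Pi.basisFun K (Fin n)).ExteriorAlgebra

theorem monBasis_apply (σ : Finset (Fin n)) : monBasis K n σ = eMon K n σ := by
  rw [monBasis, basis_apply_ofCard _ rfl, ιMulti_family, ιMulti_apply, eMon]
  congr 1
  refine List.ext_getElem (by simp) fun k hk hk' => ?_
  simp only [List.getElem_ofFn, List.getElem_map, Function.comp, Pi.basisFun_apply]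
  rfl

theorem ι_single_eq_eMon (k : Fin n) : ι K (Pi.single k (1 : K)) = eMon K n {k} := by
  simp [eMon]

theorem eMon_mul_eMon_of_not_disjoint {σ τ : Finset (Fin n)} (h : ¬Disjoint σ τ) :
    eMon K n σ * eMon K n τ = 0 := by
  rw [← monBasis_apply, ← monBasis_apply]
  exact basis_mul_of_not_disjoint (Pi.basisFun K (Fin n)) (Set.powersetCard.ofCard rfl)
    (Set.powersetCard.ofCard rfl) h

theorem eMon_mul_eMon_of_disjoint {σ τ : Finset (Fin n)} (h : Disjoint σ τ) :
    ∃ s : ℤˣ, eMon K n σ * eMon K n τ = s • eMon K n (σ ∪ τ) := by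
  rw [← monBasis_apply, ← monBasis_apply, ← monBasis_apply]
  have h' : Disjoint (Set.powersetCard.ofCard (rfl : σ.card = σ.card)).val
    (Set.powersetCard.ofCard (rfl : τ.card = τ.card)).val := h
  refine ⟨(Set.powersetCard.permOfDisjoint h').sign, (basis_mul_of_disjoint (Pi.basisFun K (Fin n)) (Set.powersetCard.ofCard rfl)
    (Set.powersetCard.ofCard rfl) h').trans ?_⟩
  congr 2
  simp [Set.powersetCard.disjUnion]

theorem eMon_mul_eMon_mem_span (σ τ : Finset (Fin n)) :
    eMon K n σ * eMon K n τ ∈ Submodule.span K {eMon K n (σ ∪ τ)} := by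
  by_cases h : Disjoint σ τ
  · obtain ⟨s, hs⟩ := eMon_mul_eMon_of_disjoint (K := K) h
    rw [hs]
    rcases Int.units_eq_one_or s with rfl | rfl <;> simp
  · rw [eMon_mul_eMon_of_not_disjoint h]
    exact zero_mem _

theorem ι_mul_eMon_of_mem {k : Fin n} {ρ : Finset (Fin n)} (h : k ∈ ρ) :
    ι K (Pi.single k (1 : K)) * eMon K n ρ = 0 := by
  rw [ι_single_eq_eMon]
  exact eMon_mul_eMon_of_not_disjoint (by simpa using h)

theorem eMon_insert {k : Fin n} {ρ : Finset (Fin n)} (h : k ∉ ρ) :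
    ∃ s : K, s * s = 1 ∧ eMon K n (insert k ρ) = s • (ι K (Pi.single k (1 : K)) * eMon K n ρ) := by
  obtain ⟨s, hs⟩ := eMon_mul_eMon_of_disjoint (K := K) (Finset.disjoint_singleton_left.2 h)
  rw [ι_single_eq_eMon, hs, Finset.insert_eq]
  rcases Int.units_eq_one_or s with rfl | rfl
  · exact ⟨1, by simp, by simp⟩
  · exact ⟨-1, by simp, by simp⟩

theorem span_eMon_eq (P : Finset (Fin n) → Prop) :
    Submodule.span K {x | ∃ σ, P σ ∧ x = eMon K n σ} =
      Submodule.span K (monBasis K n '' {σ | P σ}) := by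
  congr 1
  ext x
  simp [monBasis_apply, eq_comm]

theorem mem_span_eMon (P : Finset (Fin n) → Prop) (x : ExtAlg K n) :
    x ∈ Submodule.span K {x | ∃ σ, P σ ∧ x = eMon K n σ} ↔
      ∀ σ, (monBasis K n).repr x σ ≠ 0 → P σ := by
  rw [span_eMon_eq, Module.Basis.mem_span_image]
  simp [Set.subset_def]

theorem eMon_mem_span_eMon (P : Finset (Fin n) → Prop) (σ : Finset (Fin n)) :
    eMon K n σ ∈ Submodule.span K {x | ∃ σ, P σ ∧ x = eMon K n σ} ↔ P σ := by
  classical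
  rw [mem_span_eMon, ← monBasis_apply]
  simp [Finsupp.single_apply]

theorem mem_monSpan (d : ℕ) (x : ExtAlg K n) :
    x ∈ monSpan K n d ↔ ∀ σ, (monBasis K n).repr x σ ≠ 0 → σ.card = d :=
  mem_span_eMon _ x

theorem mem_monSpanLe (σ : Finset (Fin n)) (x : ExtAlg K n) :
    x ∈ monSpanLe K σ ↔
      ∀ ρ, (monBasis K n).repr x ρ ≠ 0 → ρ.card = σ.card ∧ revLexLe ρ σ := by
  rw [← mem_span_eMon]
  simp only [monSpanLe, and_assoc]

theorem mem_monSpanLt (σ : Finset (Fin n)) (x : ExtAlg K n) :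
    x ∈ monSpanLt K σ ↔
      ∀ ρ, (monBasis K n).repr x ρ ≠ 0 → ρ.card = σ.card ∧ revLexLe ρ σ ∧ ρ ≠ σ := by
  rw [← mem_span_eMon]
  simp only [monSpanLt, and_assoc]

theorem revLexLe_iff (τ σ : Finset (Fin n)) : revLexLe τ σ ↔ toColex σ ≤ toColex τ := by
  rw [revLexLe, le_iff_eq_or_lt, Finset.Colex.toColex_lt_toColex_iff_exists_forall_lt]
  simp [eq_comm]

theorem prod_ι_mem_monSpan (l : List (Fin n → K)) :
    (l.map (ι K)).prod ∈ monSpan K n l.length := by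
  induction l with
  | nil => exact Submodule.subset_span ⟨∅, by simp, by simp [eMon]⟩
  | cons v l ih =>
    rw [List.map_cons, List.prod_cons, List.length_cons]
    generalize (l.map (ι K)).prod = x at ih
    have hv : v = ∑ k, v k • (Pi.single k (1 : K) : Fin n → K) := by
      simpa using ((Pi.basisFun K (Fin n)).sum_repr v).symm
    rw [hv, map_sum, Finset.sum_mul]
    refine sum_mem fun k _ => ?_
    rw [map_smul, smul_mul_assoc]
    refine Submodule.smul_mem _ _ ?_
    refine Submodule.span_induction (p := fun x _ => ι K (Pi.single k (1 : K)) * x ∈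
      monSpan K n (l.length + 1)) ?_ (by simp) (fun x y _ _ hx hy => ?_)
      (fun a x _ hx => ?_) ih
    · rintro _ ⟨ρ, hρ, rfl⟩
      by_cases hk : k ∈ ρ
      · rw [ι_mul_eMon_of_mem hk]
        exact zero_mem _
      · rw [ι_single_eq_eMon]
        refine (Submodule.span_singleton_le_iff_mem _ _).2 ?_ (eMon_mul_eMon_mem_span _ _)
        exact Submodule.subset_span ⟨_, by rw [← Finset.insert_eq, Finset.card_insert_of_notMem hk,
          hρ], rfl⟩
    · rw [mul_add]
      exact add_mem hx hy
    · rw [mul_smul_comm]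
      exact Submodule.smul_mem _ _ hx

theorem matAlgMap_eMon (g : Matrix (Fin n) (Fin n) K) (σ : Finset (Fin n)) :
    matAlgMap K g (eMon K n σ) =
      ((σ.sort (· ≤ ·)).map fun k => ι K (g.col k)).prod := by
  rw [eMon, map_list_prod, List.map_map]
  congr 2
  ext1 k
  simp [matAlgMap, ExteriorAlgebra.map_apply_ι]

theorem matAlgMap_eMon_mem_monSpan (g : Matrix (Fin n) (Fin n) K) (σ : Finset (Fin n)) :
    matAlgMap K g (eMon K n σ) ∈ monSpan K n σ.card := by
  rw [matAlgMap_eMon]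
  simpa [Function.comp_def] using prod_ι_mem_monSpan ((σ.sort (· ≤ ·)).map g.col)

theorem matAlgMap_mul (g h : Matrix (Fin n) (Fin n) K) (x : ExtAlg K n) :
    matAlgMap K (g * h) x = matAlgMap K g (matAlgMap K h x) := by
  rw [matAlgMap, Matrix.toLin'_mul, ← ExteriorAlgebra.map_comp_map]
  rfl

end Monomials

section FaceIdeal

variable {K : Type} [Field K] {n : ℕ}

/-- The span of the monomials `eMon K n σ` with `σ ∉ Δ`. -/
noncomputable def nonfaceSpan (K : Type) [Field K] {n : ℕ} (Δ : Set (Finset (Fin n))) :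
    Submodule K (ExtAlg K n) :=
  Submodule.span K {x | ∃ σ : Finset (Fin n), σ ∉ Δ ∧ x = eMon K n σ}

theorem eMon_mem_nonfaceSpan {Δ : Set (Finset (Fin n))} {σ : Finset (Fin n)} (h : σ ∉ Δ) :
    eMon K n σ ∈ nonfaceSpan K Δ :=
  Submodule.subset_span ⟨σ, h, rfl⟩

theorem nonfaceSpan_le_faceIdealE (Δ : Set (Finset (Fin n))) :
    nonfaceSpan K Δ ≤ faceIdealE K Δ := by
  refine Submodule.span_mono ?_
  rintro _ ⟨σ, hσ, rfl⟩
  exact ⟨_, ⟨σ, hσ, rfl⟩, 1, 1, by simp⟩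

/-- For a family of sets closed under taking subsets, the face ideal is spanned by the monomials
of the nonfaces. -/
theorem faceIdealE_le_nonfaceSpan {Δ : Set (Finset (Fin n))}
    (hΔ : ∀ σ ∈ Δ, ∀ τ : Finset (Fin n), τ ⊆ σ → τ ∈ Δ) :
    faceIdealE K Δ ≤ nonfaceSpan K Δ := by
  have key : ∀ u, ∀ x ∈ nonfaceSpan K Δ, u * x ∈ nonfaceSpan K Δ ∧ x * u ∈ nonfaceSpan K Δ := by
    intro u x hx
    induction hx using Submodule.span_induction with
    | zero => simp
    | add x y _ _ hx hy =>
      rw [mul_add, add_mul]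
      exact ⟨add_mem hx.1 hy.1, add_mem hx.2 hy.2⟩
    | smul a x _ hx =>
      rw [mul_smul_comm, smul_mul_assoc]
      exact ⟨Submodule.smul_mem _ _ hx.1, Submodule.smul_mem _ _ hx.2⟩
    | mem x hx =>
      obtain ⟨σ, hσ, rfl⟩ := hx
      induction (monBasis K n).mem_span u using Submodule.span_induction with
      | zero => simp
      | add x y _ _ hx hy =>
        rw [mul_add, add_mul]
        exact ⟨add_mem hx.1 hy.1, add_mem hx.2 hy.2⟩
      | smul a x _ hx =>
        rw [mul_smul_comm, smul_mul_assoc]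
        exact ⟨Submodule.smul_mem _ _ hx.1, Submodule.smul_mem _ _ hx.2⟩
      | mem u hu =>
        obtain ⟨τ, rfl⟩ := hu
        rw [monBasis_apply]
        refine ⟨(Submodule.span_singleton_le_iff_mem _ _).2 (eMon_mem_nonfaceSpan fun h => ?_)
          (eMon_mul_eMon_mem_span _ _),
          (Submodule.span_singleton_le_iff_mem _ _).2 (eMon_mem_nonfaceSpan fun h => ?_)
          (eMon_mul_eMon_mem_span _ _)⟩
        · exact hσ (hΔ _ h _ Finset.subset_union_right)
        · exact hσ (hΔ _ h _ Finset.subset_union_left)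
  refine Submodule.span_le.2 ?_
  rintro _ ⟨_, ⟨σ, hσ, rfl⟩, u, v, rfl⟩
  exact (key v _ (key u _ (eMon_mem_nonfaceSpan hσ)).1).2

theorem mem_shiftOp_iff {Δ : Set (Finset (Fin n))} {p q : Fin n} (hpq : p ≠ q)
    (ρ : Finset (Fin n)) :
    ρ ∈ shiftOp Δ p q ↔ (ρ ∈ Δ ∧ (p ∈ ρ → q ∉ ρ → insert q (ρ.erase p) ∈ Δ)) ∨
      (q ∈ ρ ∧ p ∉ ρ ∧ insert p (ρ.erase q) ∈ Δ) := by
  constructor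
  · rintro ⟨σ, hσ, rfl⟩
    by_cases h : p ∈ σ ∧ q ∉ σ ∧ insert q (σ.erase p) ∉ Δ
    · rw [shiftFace, if_pos h]
      right
      refine ⟨by simp, by simp [hpq], ?_⟩
      rw [Finset.erase_insert (by simp [h.2.1]), Finset.insert_erase h.1]
      exact hσ
    · rw [shiftFace, if_neg h]
      left
      exact ⟨hσ, fun h1 h2 => by_contra fun h3 => h ⟨h1, h2, h3⟩⟩
  · by_cases hρ : ρ ∈ Δ ∧ (p ∈ ρ → q ∉ ρ → insert q (ρ.erase p) ∈ Δ)
    · intro _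
      exact ⟨ρ, hρ.1, if_neg fun h => h.2.2 (hρ.2 h.1 h.2.1)⟩
    · rintro (h | ⟨hq, hp, h⟩)
      · exact absurd h hρ
      · have hρ' : ρ ∉ Δ := fun h' => hρ ⟨h', fun h'' => absurd h'' hp⟩
        have e : insert q ((insert p (ρ.erase q)).erase p) = ρ := by
          rw [Finset.erase_insert (by simp [hp]), Finset.insert_erase hq]
        refine ⟨_, h, ?_⟩
        rw [shiftFace, if_pos ⟨by simp, by simp [hpq.symm], by rwa [e]⟩, e]

/-- Shifting preserves closure under taking subsets. -/
theorem shiftOp_subset_closed {Δ : Set (Finset (Fin n))} {p q : Fin n} (hpq : p ≠ q)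
    (hΔ : ∀ σ ∈ Δ, ∀ τ : Finset (Fin n), τ ⊆ σ → τ ∈ Δ) :
    ∀ σ ∈ shiftOp Δ p q, ∀ τ : Finset (Fin n), τ ⊆ σ → τ ∈ shiftOp Δ p q := by
  intro σ hσ τ hτ
  rw [mem_shiftOp_iff hpq] at hσ ⊢
  rcases hσ with ⟨h1, h2⟩ | ⟨hq, hp, h⟩
  · refine Or.inl ⟨hΔ _ h1 _ hτ, fun hp hq => ?_⟩
    by_cases hq' : q ∈ σ
    · refine hΔ _ h1 _ (Finset.insert_subset hq' ((Finset.erase_subset _ _).trans hτ))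
    · exact hΔ _ (h2 (hτ hp) hq') _ (Finset.insert_subset_insert _ (Finset.erase_subset_erase _ hτ))
  · have hp' : p ∉ τ := fun h => hp (hτ h)
    by_cases hq' : q ∈ τ
    · exact Or.inr ⟨hq', hp', hΔ _ h _
        (Finset.insert_subset_insert _ (Finset.erase_subset_erase _ hτ))⟩
    · refine Or.inl ⟨hΔ _ h _ fun x hx => ?_, fun hp => absurd hp hp'⟩
      exact Finset.mem_insert_of_mem (Finset.mem_erase.2 ⟨fun e => hq' (e ▸ hx), hτ hx⟩)

end FaceIdeal

section Degeneration

open ExteriorAlgebra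

variable {K : Type} [Field K] {n : ℕ}

/-- The matrix of the linear map sending `e_q` to `e_p + t e_q` and fixing the other basis
vectors. -/
def shiftMatrix (p q : Fin n) (t : K) : Matrix (Fin n) (Fin n) K :=
  (1 : Matrix (Fin n) (Fin n) K).updateCol q (Pi.single p 1 + t • Pi.single q 1)

theorem matAlgMap_shiftMatrix_ι (p q : Fin n) (t : K) :
    matAlgMap K (shiftMatrix p q t) (ι K (Pi.single q 1)) =
      ι K (Pi.single p (1 : K)) + t • ι K (Pi.single q (1 : K)) := by
  rw [matAlgMap, ExteriorAlgebra.map_apply_ι, ← map_smul, ← map_add]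
  congr 1
  ext a
  simp [shiftMatrix]

theorem matAlgMap_shiftMatrix_eMon {p q : Fin n} (t : K) {ρ : Finset (Fin n)} (h : q ∉ ρ) :
    matAlgMap K (shiftMatrix p q t) (eMon K n ρ) = eMon K n ρ := by
  rw [matAlgMap_eMon, eMon]
  congr 1
  refine List.map_congr_left fun k hk => ?_
  have hk : k ≠ q := fun e => h (e ▸ (Finset.mem_sort _).1 hk)
  congr 1
  ext a
  simp [shiftMatrix, hk, Matrix.one_apply, Pi.single_apply]

/-- Every monomial of a nonface of `shiftOp Δ p q` is the value at `t = 0` of an affine family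
whose member at each `t ≠ 0` lies in the image of the span of the nonfaces of `Δ` under
`shiftMatrix p q t`. -/
theorem exists_eMon_add_smul_mem_map {Δ : Set (Finset (Fin n))} {p q : Fin n} (hpq : p ≠ q)
    {τ : Finset (Fin n)} (hτ : τ ∉ shiftOp Δ p q) :
    ∃ w : ExtAlg K n, ∀ t : K, t ≠ 0 →
      eMon K n τ + t • w ∈
        (nonfaceSpan K Δ).map (matAlgMap K (shiftMatrix p q t)).toLinearMap := by
  rw [mem_shiftOp_iff hpq] at hτ
  push Not at hτ
  obtain ⟨h1, h2⟩ := hτ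
  by_cases hq : q ∈ τ
  · have hτΔ : τ ∉ Δ := fun h => (h1 h).2.1 hq
    set ρ := τ.erase q with hρ
    have hqρ : q ∉ ρ := by simp [hρ]
    have e : insert q ρ = τ := Finset.insert_erase hq
    obtain ⟨s, hs, hs'⟩ := eMon_insert (K := K) hqρ
    have hx : ι K (Pi.single q (1 : K)) * eMon K n ρ ∈ nonfaceSpan K Δ := by
      have := Submodule.smul_mem _ s (eMon_mem_nonfaceSpan (K := K) hτΔ)
      rwa [← e, hs', smul_smul, hs, one_smul] at this
    have hy : ι K (Pi.single p (1 : K)) * eMon K n ρ ∈ nonfaceSpan K Δ := by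
      by_cases hp : p ∈ ρ
      · rw [ι_mul_eMon_of_mem hp]
        exact zero_mem _
      · obtain ⟨r, hr, hr'⟩ := eMon_insert (K := K) hp
        have hp' : p ∉ τ := fun h => hp (Finset.mem_erase.2 ⟨hpq, h⟩)
        have := Submodule.smul_mem _ r (eMon_mem_nonfaceSpan (K := K) (h2 hq hp'))
        rwa [hr', smul_smul, hr, one_smul] at this
    refine ⟨0, fun t ht => ⟨(s * t⁻¹) • (ι K (Pi.single q (1 : K)) * eMon K n ρ -
      ι K (Pi.single p (1 : K)) * eMon K n ρ), Submodule.smul_mem _ _ (sub_mem hx hy), ?_⟩⟩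
    have hfix : matAlgMap K (shiftMatrix p q t) (ι K (Pi.single p 1)) =
        ι K (Pi.single p (1 : K)) := by
      rw [ι_single_eq_eMon, matAlgMap_shiftMatrix_eMon _ (by simpa using hpq.symm)]
    rw [AlgHom.toLinearMap_apply, map_smul, map_sub, map_mul, map_mul, hfix,
      matAlgMap_shiftMatrix_ι, matAlgMap_shiftMatrix_eMon _ hqρ, add_mul, add_sub_cancel_left,
      smul_mul_assoc, smul_smul, mul_assoc, inv_mul_cancel₀ ht, mul_one, ← e, hs', smul_zero,
      add_zero]
  · by_cases hτΔ : τ ∈ Δ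
    · obtain ⟨hp, -, h3⟩ := h1 hτΔ
      set ρ := τ.erase p with hρ
      have hqρ : q ∉ ρ := by simp [hρ, hq]
      have e : insert p ρ = τ := Finset.insert_erase hp
      obtain ⟨s, hs, hs'⟩ := eMon_insert (K := K) (show p ∉ ρ by simp [hρ])
      obtain ⟨r, hr, hr'⟩ := eMon_insert (K := K) hqρ
      have hx : ι K (Pi.single q (1 : K)) * eMon K n ρ ∈ nonfaceSpan K Δ := by
        have := Submodule.smul_mem _ r (eMon_mem_nonfaceSpan (K := K) h3)
        rwa [hr', smul_smul, hr, one_smul] at this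
      refine ⟨s • (ι K (Pi.single q (1 : K)) * eMon K n ρ), fun t _ =>
        ⟨_, Submodule.smul_mem _ s hx, ?_⟩⟩
      rw [AlgHom.toLinearMap_apply, map_smul, map_mul, matAlgMap_shiftMatrix_ι,
        matAlgMap_shiftMatrix_eMon _ hqρ, add_mul, ← e, hs', smul_add, smul_mul_assoc,
        smul_comm t s]
    · exact ⟨0, fun t _ => ⟨_, eMon_mem_nonfaceSpan hτΔ, by
        simp [matAlgMap_shiftMatrix_eMon t hq]⟩⟩

theorem exists_linearMap_add_smul_mem_map (Δ : Set (Finset (Fin n))) {p q : Fin n} (hpq : p ≠ q) :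
    ∃ W : ExtAlg K n →ₗ[K] ExtAlg K n, ∀ t : K, t ≠ 0 → ∀ y ∈ nonfaceSpan K (shiftOp Δ p q),
      y + t • W y ∈ (nonfaceSpan K Δ).map (matAlgMap K (shiftMatrix p q t)).toLinearMap := by
  classical
  have key : ∀ τ, ∃ w : ExtAlg K n, τ ∉ shiftOp Δ p q → ∀ t : K, t ≠ 0 →
      eMon K n τ + t • w ∈
        (nonfaceSpan K Δ).map (matAlgMap K (shiftMatrix p q t)).toLinearMap := by
    intro τ
    by_cases h : τ ∈ shiftOp Δ p q
    · exact ⟨0, fun h' => absurd h h'⟩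
    · obtain ⟨w, hw⟩ := exists_eMon_add_smul_mem_map (K := K) hpq h
      exact ⟨w, fun _ => hw⟩
  choose w hw using key
  refine ⟨(monBasis K n).constr K w, fun t ht y hy => ?_⟩
  induction hy using Submodule.span_induction with
  | zero => simp
  | add x y _ _ hx hy =>
    rw [map_add, smul_add, add_add_add_comm]
    exact add_mem hx hy
  | smul a x _ hx =>
    rw [map_smul, smul_comm, ← smul_add]
    exact Submodule.smul_mem _ _ hx
  | mem x hx =>
    obtain ⟨τ, hτ, rfl⟩ := hx
    have := (monBasis K n).constr_basis K w τ
    rw [monBasis_apply] at this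
    rw [this]
    exact hw τ hτ t ht

end Degeneration

section Counting

variable {K : Type} [Field K] {n : ℕ}

/-- The coordinates at the monomials of degree `d` in the first `i` variables. -/
noncomputable def firstCoords (K : Type) [Field K] (n i d : ℕ) :
    ExtAlg K n →ₗ[K] ({σ : Finset (Fin n) // σ.card = d ∧ ∀ k ∈ σ, (k : ℕ) < i} → K) :=
  LinearMap.pi fun σ => (monBasis K n).coord σ

theorem firstCoords_apply (i d : ℕ) (x : ExtAlg K n)
    (σ : {σ : Finset (Fin n) // σ.card = d ∧ ∀ k ∈ σ, (k : ℕ) < i}) :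
    firstCoords K n i d x σ = (monBasis K n).repr x σ := rfl

/-- The monomials counted by `mLeE` for an initial ideal are the initial monomials. -/
theorem mLeE_initialIdealE (I : Submodule K (ExtAlg K n)) (i d : ℕ) :
    mLeE (initialIdealE K I) i d = Nat.card
      {σ : Finset (Fin n) // σ.card = d ∧ (∀ k ∈ σ, (k : ℕ) < i) ∧ IsInitialMonomial I σ} := by
  simp only [mLeE, initialIdealE, eMon_mem_span_eMon]

/-- Elements with distinct initial monomials in the first `i` variables are linearly independent
modulo the remaining variables. -/
theorem exists_linearIndependent_firstCoords (I : Submodule K (ExtAlg K n)) (i d : ℕ) :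
    ∃ f : {σ : Finset (Fin n) // σ.card = d ∧ (∀ k ∈ σ, (k : ℕ) < i) ∧ IsInitialMonomial I σ} →
      ExtAlg K n, (∀ σ, f σ ∈ I) ∧ LinearIndependent K fun σ => firstCoords K n i d (f σ) := by
  classical
  choose f hfI hfle hflt _ using
    fun σ : {σ : Finset (Fin n) // σ.card = d ∧ (∀ k ∈ σ, (k : ℕ) < i) ∧ IsInitialMonomial I σ} =>
      σ.2.2.2
  refine ⟨f, hfI, ?_⟩
  rw [Fintype.linearIndependent_iff]
  intro c hc
  by_contra! hne
  obtain ⟨σ, hσ, hmin⟩ := Finset.exists_min_image (Finset.univ.filter fun σ => c σ ≠ 0)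
    (fun σ => toColex σ.1) (by obtain ⟨σ, hσ⟩ := hne; exact ⟨σ, by simpa using hσ⟩)
  simp only [Finset.mem_filter, Finset.mem_univ, true_and] at hσ hmin
  have hlead : (monBasis K n).repr (f σ) σ ≠ 0 := by
    intro h0
    refine hflt σ ((mem_monSpanLt _ _).2 fun ρ hρ => ?_)
    obtain ⟨h1, h2⟩ := (mem_monSpanLe _ _).1 (hfle σ) ρ hρ
    exact ⟨h1, h2, fun e => hρ (e ▸ h0)⟩
  have h := congr_fun hc ⟨σ.1, σ.2.1, σ.2.2.1⟩
  simp only [Finset.sum_apply, Pi.smul_apply, firstCoords_apply, smul_eq_mul,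
    Pi.zero_apply] at h
  rw [Finset.sum_eq_single σ] at h
  · exact (mul_ne_zero hσ hlead) h
  · intro τ _ hτ
    by_contra hmul
    have hcτ := left_ne_zero_of_mul hmul
    obtain ⟨-, h2⟩ := (mem_monSpanLe _ _).1 (hfle τ) σ (right_ne_zero_of_mul hmul)
    have h3 := (hmin τ hcτ).antisymm ((revLexLe_iff _ _).1 h2)
    exact hτ (Subtype.ext (toColex.injective h3)).symm
  · simp

/-- A family of elements of degree `d` that is linearly independent modulo all but the first `i`
variables is at most as large as the number of initial monomials in these variables. -/
theorem card_le_of_linearIndependent_firstCoords (I : Submodule K (ExtAlg K n)) (i d : ℕ)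
    {ι : Type} [Fintype ι] (z : ι → ExtAlg K n) (hzI : ∀ j, z j ∈ I)
    (hzd : ∀ j, z j ∈ monSpan K n d)
    (hz : LinearIndependent K fun j => firstCoords K n i d (z j)) :
    Fintype.card ι ≤ Nat.card
      {σ : Finset (Fin n) // σ.card = d ∧ (∀ k ∈ σ, (k : ℕ) < i) ∧ IsInitialMonomial I σ} := by
  classical
  by_contra! hlt
  rw [Nat.card_eq_fintype_card] at hlt
  let Φ : (ι → K) →ₗ[K]
      ({σ : Finset (Fin n) // σ.card = d ∧ (∀ k ∈ σ, (k : ℕ) < i) ∧ IsInitialMonomial I σ} → K) :=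
    LinearMap.pi fun σ => (monBasis K n).coord σ ∘ₗ Fintype.linearCombination K z
  obtain ⟨c, hc, hc0⟩ := Submodule.exists_mem_ne_zero_of_ne_bot
    (LinearMap.ker_ne_bot_of_finrank_lt (f := Φ) (by simpa using hlt))
  set y := Fintype.linearCombination K z c with hy
  have hyI : y ∈ I := sum_mem fun j _ => I.smul_mem _ (hzI j)
  have hyd : y ∈ monSpan K n d := sum_mem fun j _ => Submodule.smul_mem _ _ (hzd j)
  have hy0 : firstCoords K n i d y ≠ 0 := by
    intro h
    rw [hy, Fintype.linearCombination_apply, map_sum] at h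
    simp only [map_smul] at h
    exact hc0 (funext (Fintype.linearIndependent_iff.1 hz c h))
  obtain ⟨σ₀, hσ₀⟩ := Function.ne_iff.1 hy0
  rw [firstCoords_apply, Pi.zero_apply] at hσ₀
  obtain ⟨σ, hσ, hmin⟩ := Finset.exists_min_image ((monBasis K n).repr y).support
    (fun σ => toColex σ) ⟨σ₀.1, by simpa using hσ₀⟩
  simp only [Finsupp.mem_support_iff] at hσ hmin
  rw [mem_monSpan] at hyd
  have hσi : ∀ k ∈ σ, (k : ℕ) < i := by
    intro k hk
    by_cases hk' : k ∈ σ₀.1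
    · exact σ₀.2.2 k hk'
    · obtain ⟨b, hb, -, hkb⟩ := Finset.Colex.toColex_le_toColex.1 (hmin _ hσ₀) hk hk'
      exact lt_of_le_of_lt hkb (σ₀.2.2 b hb)
  have hInitial : IsInitialMonomial I σ := by
    refine ⟨y, hyI, (mem_monSpanLe _ _).2 fun ρ hρ => ⟨(hyd ρ hρ).trans (hyd σ hσ).symm,
      (revLexLe_iff _ _).2 (hmin ρ hρ)⟩, fun h => ((mem_monSpanLt _ _).1 h σ hσ).2.2 rfl, ?_⟩
    intro h
    simp [h] at hσ
  exact hσ (congr_fun (LinearMap.mem_ker.1 hc) ⟨σ, hyd σ hσ, hσi, hInitial⟩)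

/-- Discarding the monomials of degree other than `d` does not affect the coordinates of degree
`d` of the image under a matrix. -/
theorem exists_degree_part {Δ : Set (Finset (Fin n))} (g : Matrix (Fin n) (Fin n) K) (i d : ℕ)
    {x : ExtAlg K n} (hx : x ∈ nonfaceSpan K Δ) :
    ∃ y ∈ nonfaceSpan K Δ, matAlgMap K g y ∈ monSpan K n d ∧
      firstCoords K n i d (matAlgMap K g y) = firstCoords K n i d (matAlgMap K g x) := by
  induction hx using Submodule.span_induction with
  | zero => exact ⟨0, by simp⟩
  | add x x' _ _ hx hx' =>
    obtain ⟨y, hy1, hy2, hy3⟩ := hx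
    obtain ⟨y', hy1', hy2', hy3'⟩ := hx'
    refine ⟨y + y', add_mem hy1 hy1', ?_, ?_⟩
    · rw [map_add]
      exact add_mem hy2 hy2'
    · simp only [map_add, hy3, hy3']
  | smul a x _ hx =>
    obtain ⟨y, hy1, hy2, hy3⟩ := hx
    refine ⟨a • y, Submodule.smul_mem _ _ hy1, ?_, ?_⟩
    · rw [map_smul]
      exact Submodule.smul_mem _ _ hy2
    · simp only [map_smul, hy3]
  | mem x hx =>
    obtain ⟨σ, hσ, rfl⟩ := hx
    have h := matAlgMap_eMon_mem_monSpan g σ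
    by_cases hd : σ.card = d
    · exact ⟨_, eMon_mem_nonfaceSpan hσ, hd ▸ h, rfl⟩
    · refine ⟨0, zero_mem _, by simp, ?_⟩
      ext τ
      rw [map_zero, map_zero, firstCoords_apply, Pi.zero_apply]
      by_contra h0
      exact hd (((mem_monSpan _ _).1 h _ (Ne.symm h0)).symm.trans τ.2.1)

end Counting

section Generic

open ExteriorAlgebra

/-- A linearly independent finite family admits functionals whose evaluation matrix is
nonsingular. -/
theorem LinearIndependent.exists_det_ne_zero {K W ι : Type*} [Field K] [AddCommGroup W]
    [Module K W] [Fintype ι] [DecidableEq ι] {v : ι → W} (hv : LinearIndependent K v) :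
    ∃ l : ι → W →ₗ[K] K, (Matrix.of fun a b => l a (v b)).det ≠ 0 := by
  obtain ⟨r, hr⟩ := LinearMap.exists_leftInverse_of_injective (Fintype.linearCombination K v)
    (LinearMap.ker_eq_bot'.2 fun c hc => funext (Fintype.linearIndependent_iff.1 hv c hc))
  refine ⟨fun a => LinearMap.proj a ∘ₗ r, ?_⟩
  have : (Matrix.of fun a b => (LinearMap.proj a ∘ₗ r : W →ₗ[K] K) (v b)) = 1 := by
    ext a b
    have h := congr_fun (LinearMap.congr_fun hr (Pi.single b 1)) a
    simpa [Fintype.linearCombination_apply_single, Matrix.one_apply, Pi.single_apply] using h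
  rw [this, Matrix.det_one]
  exact one_ne_zero

theorem linearIndependent_of_det_ne_zero {K W ι : Type*} [Field K] [AddCommGroup W]
    [Module K W] [Fintype ι] [DecidableEq ι] {v : ι → W} (l : ι → W →ₗ[K] K)
    (h : (Matrix.of fun a b => l a (v b)).det ≠ 0) : LinearIndependent K v := by
  rw [Fintype.linearIndependent_iff]
  intro c hc
  refine congr_fun (Matrix.eq_zero_of_mulVec_eq_zero h (funext fun a => ?_))
  have := congr_arg (l a) hc
  rw [map_sum, map_zero] at this
  simpa [Matrix.mulVec, dotProduct, mul_comm] using this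

/-- Linear independence at `t = 0` of an affine family persists at some `t ≠ 0`. -/
theorem LinearIndependent.exists_add_smul {K W ι : Type*} [Field K] [Infinite K]
    [AddCommGroup W] [Module K W] [Finite ι] {v : ι → W} (hv : LinearIndependent K v)
    (w : ι → W) : ∃ t : K, t ≠ 0 ∧ LinearIndependent K fun j => v j + t • w j := by
  classical
  have := Fintype.ofFinite ι
  obtain ⟨l, hl⟩ := hv.exists_det_ne_zero
  let M : Matrix ι ι (Polynomial K) := Matrix.of fun a b =>
    Polynomial.C (l a (v b)) + Polynomial.X * Polynomial.C (l a (w b))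
  have hM : ∀ t, M.det.eval t = (Matrix.of fun a b => l a (v b + t • w b)).det := by
    intro t
    rw [← Polynomial.coe_evalRingHom, RingHom.map_det]
    congr 1
    ext a b
    simp [M, mul_comm t]
  have hne : Polynomial.X * M.det ≠ 0 := by
    refine mul_ne_zero Polynomial.X_ne_zero fun h0 => hl ?_
    have := hM 0
    rw [h0] at this
    simpa using this.symm
  obtain ⟨t, ht⟩ : ∃ t, (Polynomial.X * M.det).eval t ≠ 0 := by
    by_contra! h
    exact hne (Polynomial.funext fun t => by simpa using h t)
  rw [Polynomial.eval_mul, Polynomial.eval_X, hM] at ht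
  exact ⟨t, left_ne_zero_of_mul ht, linearIndependent_of_det_ne_zero l (right_ne_zero_of_mul ht)⟩

variable {K : Type} [Field K] {n : ℕ}

theorem exists_polynomial_prod_ι_col (s : List (Fin n)) : ∀ l : ExtAlg K n →ₗ[K] K,
    ∃ P : MvPolynomial (Fin n × Fin n) K, ∀ g : Matrix (Fin n) (Fin n) K,
      MvPolynomial.eval (fun kl => g kl.1 kl.2) P = l (s.map fun k => ι K (g.col k)).prod := by
  induction s with
  | nil => exact fun l => ⟨MvPolynomial.C (l 1), by simp⟩
  | cons k s ih =>
    intro l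
    choose P hP using fun a : Fin n =>
      ih (l ∘ₗ LinearMap.mulLeft K (ι K (Pi.single a (1 : K))))
    refine ⟨∑ a, MvPolynomial.X (a, k) * P a, fun g => ?_⟩
    have hv : g.col k = ∑ a, g a k • (Pi.single a (1 : K) : Fin n → K) := by
      simpa using ((Pi.basisFun K (Fin n)).sum_repr (g.col k)).symm
    rw [List.map_cons, List.prod_cons, hv]
    simp [hP, Finset.sum_mul]

/-- The coordinates of the image of a fixed element under a matrix are polynomials in the matrix
entries. -/
theorem exists_polynomial_matAlgMap (x : ExtAlg K n) (l : ExtAlg K n →ₗ[K] K) :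
    ∃ P : MvPolynomial (Fin n × Fin n) K, ∀ g : Matrix (Fin n) (Fin n) K,
      MvPolynomial.eval (fun kl => g kl.1 kl.2) P = l (matAlgMap K g x) := by
  induction (monBasis K n).mem_span x using Submodule.span_induction with
  | zero => exact ⟨0, by simp⟩
  | add x y _ _ hx hy =>
    obtain ⟨P, hP⟩ := hx
    obtain ⟨Q, hQ⟩ := hy
    exact ⟨P + Q, fun g => by simp [hP, hQ]⟩
  | smul a x _ hx =>
    obtain ⟨P, hP⟩ := hx
    exact ⟨MvPolynomial.C a * P, fun g => by simp [hP]⟩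
  | mem x hx =>
    obtain ⟨σ, rfl⟩ := hx
    obtain ⟨P, hP⟩ := exists_polynomial_prod_ι_col (K := K) (σ.sort (· ≤ ·)) l
    exact ⟨P, fun g => by rw [hP, monBasis_apply, matAlgMap_eMon]⟩

/-- Linear independence of the images under one matrix is inherited by generic matrices. -/
theorem exists_polynomial_linearIndependent {W κ : Type*} [AddCommGroup W] [Module K W]
    [Finite κ] (L : ExtAlg K n →ₗ[K] W) (x : κ → ExtAlg K n) (g₀ : Matrix (Fin n) (Fin n) K)
    (h : LinearIndependent K fun j => L (matAlgMap K g₀ (x j))) :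
    ∃ P : MvPolynomial (Fin n × Fin n) K, P ≠ 0 ∧ ∀ g : Matrix (Fin n) (Fin n) K,
      MvPolynomial.eval (fun kl => g kl.1 kl.2) P ≠ 0 →
        LinearIndependent K fun j => L (matAlgMap K g (x j)) := by
  classical
  have := Fintype.ofFinite κ
  obtain ⟨l, hl⟩ := h.exists_det_ne_zero
  choose P hP using fun a b => exists_polynomial_matAlgMap (x b) (l a ∘ₗ L)
  have hdet : ∀ g : Matrix (Fin n) (Fin n) K,
      MvPolynomial.eval (fun kl => g kl.1 kl.2) (Matrix.of P).det =
        (Matrix.of fun a b => l a (L (matAlgMap K g (x b)))).det := by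
    intro g
    rw [RingHom.map_det]
    congr 1
    ext a b
    simp [hP]
  refine ⟨(Matrix.of P).det, fun h0 => hl ?_, fun g hg => ?_⟩
  · rw [← hdet, h0, map_zero]
  · rw [hdet] at hg
    exact linearIndependent_of_det_ne_zero l hg

/-- Over an infinite field some invertible matrix avoids the zero locus of a nonzero
polynomial. -/
theorem exists_isUnit_det_eval_ne_zero [Infinite K] {P : MvPolynomial (Fin n × Fin n) K}
    (hP : P ≠ 0) : ∃ g : Matrix (Fin n) (Fin n) K, IsUnit g.det ∧
      MvPolynomial.eval (fun kl => g kl.1 kl.2) P ≠ 0 := by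
  have hdet := Matrix.det_mvPolynomialX_ne_zero (Fin n) K
  obtain ⟨x, hx⟩ : ∃ x,
      MvPolynomial.eval x (P * (Matrix.mvPolynomialX (Fin n) (Fin n) K).det) ≠ 0 := by
    by_contra! h
    exact mul_ne_zero hP hdet (MvPolynomial.funext fun x => by simpa using h x)
  rw [map_mul] at hx
  refine ⟨Matrix.of fun a b => x (a, b), ?_, by simpa using left_ne_zero_of_mul hx⟩
  have := right_ne_zero_of_mul hx
  rw [RingHom.map_det] at this
  rw [isUnit_iff_ne_zero]
  convert this using 2
  ext a b
  simp [Matrix.mvPolynomialX]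

end Generic

/-- **Inequality (1).** Let `Δ` be a simplicial complex on `[n]` over an infinite
field `K`, and `1 ≤ p < q ≤ n`. Then for all `i` and `d` one has
`m_{≤i}(Gin^E(J_Δ), d) ≥ m_{≤i}(Gin^E(J_{Shift_{pq}(Δ)}), d)`. -/
theorem mLe_gin_shiftOp_le (K : Type) [Field K] [Infinite K] (n : ℕ)
    (Δ : Set (Finset (Fin n))) (hΔ : IsSimplicialComplex Δ)
    (p q : Fin n) (hpq : p < q)
    (J J' : Submodule K (ExtAlg K n))
    (hGin : IsGinE (faceIdealE K Δ) J)
    (hGin' : IsGinE (faceIdealE K (shiftOp Δ p q)) J')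
    (i d : ℕ) :
    mLeE J' i d ≤ mLeE J i d := by
  obtain ⟨P, hP, hJ⟩ := hGin
  obtain ⟨P', hP', hJ'⟩ := hGin'
  obtain ⟨g', hg', hgP'⟩ := exists_isUnit_det_eval_ne_zero hP'
  rw [← hJ' g' hg' hgP', mLeE_initialIdealE]
  obtain ⟨f, hf, hfli⟩ := exists_linearIndependent_firstCoords
    (applyMat K g' (faceIdealE K (shiftOp Δ p q))) i d
  choose y hy hyf using hf
  obtain ⟨W, hW⟩ := exists_linearMap_add_smul_mem_map (K := K) Δ hpq.ne
  obtain ⟨t, ht, hli⟩ := hfli.exists_add_smul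
    fun σ => firstCoords K n i d (matAlgMap K g' (W (y σ)))
  choose x hx hxy using fun σ => hW t ht (y σ)
    (faceIdealE_le_nonfaceSpan (shiftOp_subset_closed hpq.ne hΔ.2) (hy σ))
  have hxli : LinearIndependent K fun σ =>
      firstCoords K n i d (matAlgMap K (g' * shiftMatrix p q t) (x σ)) := by
    have h : ∀ σ, firstCoords K n i d (matAlgMap K (g' * shiftMatrix p q t) (x σ)) =
        firstCoords K n i d (f σ) + t • firstCoords K n i d (matAlgMap K g' (W (y σ))) := by
      intro σ
      have h := hxy σ
      rw [AlgHom.toLinearMap_apply] at h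
      rw [matAlgMap_mul, h, map_add, map_smul, map_add, map_smul, ← hyf σ]
      rfl
    simpa only [h] using hli
  obtain ⟨Q, hQ, hQli⟩ := exists_polynomial_linearIndependent _ x _ hxli
  obtain ⟨g, hg, hgPQ⟩ := exists_isUnit_det_eval_ne_zero (mul_ne_zero hP hQ)
  rw [map_mul] at hgPQ
  rw [← hJ g hg (left_ne_zero_of_mul hgPQ), mLeE_initialIdealE]
  choose z hz hzd hzx using fun σ => exists_degree_part g i d (hx σ)
  have := Fintype.ofFinite {σ : Finset (Fin n) // σ.card = d ∧ (∀ k ∈ σ, (k : ℕ) < i) ∧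
    IsInitialMonomial (applyMat K g' (faceIdealE K (shiftOp Δ p q))) σ}
  rw [Nat.card_eq_fintype_card]
  refine card_le_of_linearIndependent_firstCoords _ i d (fun σ => matAlgMap K g (z σ))
    (fun σ => ⟨z σ, nonfaceSpan_le_faceIdealE Δ (hz σ), rfl⟩) hzd ?_
  simp only [hzx]
  exact hQli g (right_ne_zero_of_mul hgPQ)
end
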